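/- arXiv:2212.10235 — 2 statements merged into one kernel-verified Lean document; each statement's English description precedes it below -/
import Mathlib

section
/- Let T be a (p,q)-banded matrix with nonvanishing extreme diagonals and let A^{(a)}_n (a ∈ {1,…,p}) be the left recursion polynomials for any choice of the constants ν^{(a)}_j. Then for every N ∈ ℕ, the characteristic polynomial satisfies P_N = α_N · det A_N as an identity in ℝ[x], where A_N is the p×p matrix of polynomials with (a,j) entry A^{(a)}_{N+j} (a ∈ {1,…,p}, j ∈ {0,…,p−1}). -/
theorem finRotate_pow_val (n k : ℕ) (i : Fin n) :
    (((finRotate n) ^ k) i : ℕ) = ((i : ℕ) + k) % n := by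
  induction k with
  | zero => simp [Nat.mod_eq_of_lt i.isLt]
  | succ k ih =>
    have := i.neZero
    rw [pow_succ', Equiv.Perm.mul_apply, finRotate_apply, Fin.val_add, ih, Fin.coe_ofNat_eq_mod]
    simp [add_assoc]

/-- For a `(p,q)`-banded matrix with nonvanishing extreme diagonals, the characteristic
polynomials of the leading principal submatrices satisfy `P_N = α_N · det A_N`, where
`A_N` is the `p×p` matrix of left recursion polynomials with `(a,j)` entry `A^{(a)}_{N+j}`. -/
theorem charpoly_eq_det_left_recursion
    (p q : ℕ) (hp : 1 ≤ p) (hq : 1 ≤ q)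
    (T : ℕ → ℕ → ℝ)
    (hband : ∀ i j, (j + p < i ∨ i + q < j) → T i j = 0)
    (hext : ∀ n, T (n + p) n ≠ 0 ∧ T n (n + q) ≠ 0)
    (ν : ℕ → ℕ → ℝ) (A : ℕ → ℕ → Polynomial ℝ)
    (hA0 : ∀ a, 1 ≤ a → a ≤ p → ∀ n, n < a - 1 → A a n = 0)
    (hA1 : ∀ a, 1 ≤ a → a ≤ p → A a (a - 1) = 1)
    (hAconst : ∀ a, 1 ≤ a → a ≤ p → ∀ j, a ≤ j → j ≤ p - 1 → A a j = Polynomial.C (ν a j))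
    (hArec : ∀ a, 1 ≤ a → a ≤ p → ∀ n,
      ∑ m ∈ Finset.Icc (n - q) (n + p), A a m * Polynomial.C (T m n)
        = Polynomial.X * A a n)
    (P : ℕ → Polynomial ℝ)
    (hP0 : P 0 = 1)
    (hPsucc : ∀ N, P (N + 1) = (Matrix.of fun i j : Fin (N + 1) => T i j).charpoly)
    (α : ℕ → ℝ)
    (hα : ∀ N, α N = (-1 : ℝ) ^ ((p - 1) * N) * ∏ k ∈ Finset.range N, T (k + p) k) :
    ∀ N, P N = Polynomial.C (α N) *
      (Matrix.of fun a j : Fin p => A ((a : ℕ) + 1) (N + (j : ℕ))).det := by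
  intro N
  have hP : P N = (Matrix.of fun i j : Fin N => T i j).charpoly := by
    cases N with
    | zero => rw [hP0]; simp [Matrix.charpoly]
    | succ N => exact hPsucc N
  -- the banded matrix `x - T`, completed by unit columns
  let E : ℕ → ℕ → Polynomial ℝ := fun m n =>
    if n < N then (if m = n then Polynomial.X else 0) - Polynomial.C (T m n)
    else if m = n then 1 else 0
  let U : Matrix (Fin (N + p)) (Fin (N + p)) (Polynomial ℝ) := Matrix.of fun i j =>
    if (i : ℕ) < p then A ((i : ℕ) + 1) j else if i = j then 1 else 0
  let W : Matrix (Fin (N + p)) (Fin (N + p)) (Polynomial ℝ) := Matrix.of fun i j => E i j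
  have hU : U.det = 1 := by
    rw [Matrix.det_of_upperTriangular]
    · apply Finset.prod_eq_one
      intro i _
      by_cases h : (i : ℕ) < p
      · simpa [U, h] using hA1 (i + 1) (by omega) (by omega)
      · simp [U, h]
    · intro i j hij
      have hij' : (j : ℕ) < i := hij
      by_cases h : (i : ℕ) < p
      · simpa [U, h] using hA0 (i + 1) (by omega) (by omega) j (by omega)
      · have : i ≠ j := by rintro rfl; omega
        simp [U, h, this]
  have hW : W.det = P N := by
    rw [hP, ← Matrix.det_submatrix_equiv_self (finSumFinEquiv (m := N) (n := p)) W,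
      ← Matrix.fromBlocks_toBlocks (W.submatrix _ _)]
    have h12 : (W.submatrix (finSumFinEquiv (m := N) (n := p)) finSumFinEquiv).toBlocks₁₂ = 0 := by
      ext1 i j
      have : (i : ℕ) ≠ N + j := by omega
      simp [Matrix.toBlocks₁₂, W, E, this]
    have h22 : (W.submatrix (finSumFinEquiv (m := N) (n := p)) finSumFinEquiv).toBlocks₂₂ = 1 := by
      ext1 i j
      simp [Matrix.toBlocks₂₂, W, E, Matrix.one_apply, Fin.ext_iff]
    have h11 : (W.submatrix (finSumFinEquiv (m := N) (n := p)) finSumFinEquiv).toBlocks₁₁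
        = (Matrix.of fun i j : Fin N => T i j).charmatrix := by
      ext1 i j
      simp [Matrix.toBlocks₁₁, W, E, Matrix.charmatrix_apply, Matrix.diagonal_apply, Fin.ext_iff]
    rw [h12, h22, h11, Matrix.det_fromBlocks_zero₁₂, Matrix.det_one, mul_one, Matrix.charpoly]
  -- entries of the product
  have hM1 : ∀ i n : Fin (N + p), (i : ℕ) < p → (n : ℕ) < N → (U * W) i n = 0 := by
    intro i n hi hn
    rw [Matrix.mul_apply]
    have h1 : ∀ m : Fin (N + p), U i m * W m n
        = (fun m : ℕ => (if m = (n : ℕ) then A ((i : ℕ) + 1) m * Polynomial.X else 0)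
          - A ((i : ℕ) + 1) m * Polynomial.C (T m n)) m := by
      intro m
      simp only [U, W, E, Matrix.of_apply, hi, hn, if_true, mul_sub, mul_ite, mul_zero]
    rw [Finset.sum_congr rfl (fun m _ => h1 m), Fin.sum_univ_eq_sum_range
        (fun m : ℕ => (if m = (n : ℕ) then A ((i : ℕ) + 1) m * Polynomial.X else 0)
          - A ((i : ℕ) + 1) m * Polynomial.C (T m n)), Finset.sum_sub_distrib,
      Finset.sum_ite_eq', if_pos (by simp), sub_eq_zero, mul_comm,
      ← hArec (i + 1) (by omega) (by omega) n]
    apply Finset.sum_subset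
    · intro m hm
      simp only [Finset.mem_Icc, Finset.mem_range] at *
      omega
    · intro m _ hm
      rw [hband m n (by simp only [Finset.mem_Icc] at hm; omega)]
      simp
  have hM2 : ∀ i n : Fin (N + p), (i : ℕ) < p → N ≤ (n : ℕ) →
      (U * W) i n = A ((i : ℕ) + 1) n := by
    intro i n hi hn
    rw [Matrix.mul_apply, Finset.sum_eq_single n]
    · simp [U, W, E, hi, hn]
    · intro m _ hm
      have : (m : ℕ) ≠ n := fun h => hm (Fin.ext h)
      simp [W, E, hn, this]
    · simp
  have hM3 : ∀ i n : Fin (N + p), p ≤ (i : ℕ) → (U * W) i n = E i n := by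
    intro i n hi
    rw [Matrix.mul_apply, Finset.sum_eq_single i]
    · simp [U, W, hi]
    · intro m _ hm
      simp [U, hi, hm.symm]
    · simp
  -- rotate the rows
  let σ : Equiv.Perm (Fin (N + p)) := (finRotate (N + p)) ^ p
  let V := (U * W).submatrix σ id
  have hσ1 : ∀ k : Fin N, (σ (finSumFinEquiv (Sum.inl k)) : ℕ) = k + p := by
    intro k
    rw [finRotate_pow_val, finSumFinEquiv_apply_left, Fin.val_castAdd]
    exact Nat.mod_eq_of_lt (by omega)
  have hσ2 : ∀ a : Fin p, (σ (finSumFinEquiv (Sum.inr a)) : ℕ) = a := by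
    intro a
    rw [finRotate_pow_val, finSumFinEquiv_apply_right, Fin.val_natAdd,
      show N + (a : ℕ) + p = a + (N + p) by omega, Nat.add_mod_right]
    exact Nat.mod_eq_of_lt (by omega)
  have hV : V.det = (∏ k : Fin N, -Polynomial.C (T (k + p) k)) *
      (Matrix.of fun a j : Fin p => A ((a : ℕ) + 1) (N + (j : ℕ))).det := by
    rw [← Matrix.det_submatrix_equiv_self (finSumFinEquiv (m := N) (n := p)) V,
      ← Matrix.fromBlocks_toBlocks (V.submatrix _ _)]
    have h21 : (V.submatrix (finSumFinEquiv (m := N) (n := p)) finSumFinEquiv).toBlocks₂₁ = 0 := by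
      ext1 a n
      exact hM1 _ _ (by rw [hσ2]; exact a.isLt) (by simp)
    have h22 : (V.submatrix (finSumFinEquiv (m := N) (n := p)) finSumFinEquiv).toBlocks₂₂
        = Matrix.of fun a j : Fin p => A ((a : ℕ) + 1) (N + (j : ℕ)) := by
      ext1 a j
      refine (hM2 _ _ (by rw [hσ2]; exact a.isLt) (by simp)).trans ?_
      rw [hσ2]; simp
    have h11 : ∀ k n, (V.submatrix (finSumFinEquiv (m := N) (n := p)) finSumFinEquiv).toBlocks₁₁ k n
        = E (k + p) n := by
      intro k n
      refine (hM3 _ _ (by rw [hσ1]; omega)).trans ?_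
      rw [hσ1]; simp
    rw [h21, h22, Matrix.det_fromBlocks_zero₂₁, Matrix.det_of_upperTriangular]
    · congr 1
      apply Finset.prod_congr rfl
      intro k _
      rw [h11]
      simp [E, show p ≠ 0 by omega]
    · intro k n hkn
      have hkn' : (n : ℕ) < k := hkn
      rw [h11]
      simp [E, show (k : ℕ) + p ≠ n by omega, hband (k + p) n (by omega)]
  have hV2 : V.det = (-1) ^ ((N + p - 1) * p) * P N := by
    rw [Matrix.det_permute, Matrix.det_mul, hU, hW, one_mul, map_pow, sign_finRotate, ← pow_mul]
    simp
  have hpar : ((-1 : Polynomial ℝ) ^ ((N + p - 1) * p)) * (-1) ^ N = (-1) ^ ((p - 1) * N) := by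
    obtain ⟨r, rfl⟩ : ∃ r, p = r + 1 := ⟨p - 1, by omega⟩
    have e : (N + (r + 1) - 1) * (r + 1) + N = (r + 1 - 1) * N + (2 * N + r * (r + 1)) := by
      simp only [← add_assoc, Nat.add_sub_cancel]; ring
    rw [← pow_add, e, pow_add]
    have : Even (2 * N + r * (r + 1)) := (even_two_mul N).add (Nat.even_mul_succ_self r)
    rw [this.neg_one_pow, mul_one]
  have hsq : ((-1 : Polynomial ℝ) ^ ((N + p - 1) * p)) * (-1) ^ ((N + p - 1) * p) = 1 := by
    rw [← mul_pow]; simp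
  have hprod : (∏ k : Fin N, -Polynomial.C (T (k + p) k))
      = (-1) ^ N * Polynomial.C (∏ k ∈ Finset.range N, T (k + p) k) := by
    rw [Finset.prod_neg, ← Fin.prod_univ_eq_prod_range (fun k => T (k + p) k), map_prod]
    simp
  calc P N = (-1) ^ ((N + p - 1) * p) * ((-1) ^ ((N + p - 1) * p) * P N) := by
        rw [← mul_assoc, hsq, one_mul]
    _ = _ := by
        rw [← hV2, hV, hprod, hα, Polynomial.C_mul, ← mul_assoc, ← mul_assoc, hpar]
        simp
end

section
/- Let T be a (p,q)-banded matrix with nonvanishing extreme diagonals, with determinantal polynomials Q_{n,N} and R_{n,N}. Fix N ∈ ℕ and assume the characteristic polynomials have only real simple roots which strictly interlace: P_{N+1}(x) = ∏_{k=1}^{N+1}(x − λ_k) with λ_1 > … > λ_{N+1}, P_N(x) = ∏_{k=1}^{N}(x − μ_k) with μ_1 > … > μ_N, and λ_{k+1} < μ_k < λ_k for every k ∈ {1,…,N}. Then α_N · β_N · ∑_{n=0}^{N} Q_{n,N}(x) · R_{n,N}(x) > 0 for every x ∈ ℝ. -/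
open Polynomial in
theorem interlace_pos (N : ℕ) (lam : Fin (N + 1) → ℝ) (mu : Fin N → ℝ)
    (hlam : StrictAnti lam)
    (hint : ∀ k : Fin N, lam k.succ < mu k ∧ mu k < lam k.castSucc)
    (F G : ℝ[X]) (hF : F = ∏ k, (X - C (lam k))) (hG : G = ∏ k, (X - C (mu k))) (x : ℝ) :
    0 < (derivative F * G - F * derivative G).eval x := by
  classical
  set L : Fin (N + 1) → ℝ[X] := fun k => ∏ j : Fin N, (X - C (lam (k.succAbove j))) with hL
  have hFL : ∀ k, F = (X - C (lam k)) * L k := by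
    intro k
    rw [hF, Fin.prod_univ_succAbove _ k]
  have hLeval : ∀ k y, (L k).eval y = ∏ j : Fin N, (y - lam (k.succAbove j)) := by
    intro k y
    simp [hL, eval_prod]
  have hLne : ∀ k, (L k).eval (lam k) ≠ 0 := by
    intro k
    rw [hLeval, Finset.prod_ne_zero_iff]
    intro j _
    exact sub_ne_zero.2 (fun h => (Fin.succAbove_ne k j) (hlam.injective h).symm)
  have hLz : ∀ k i, i ≠ k → (L k).eval (lam i) = 0 := by
    intro k i hik
    obtain ⟨j, rfl⟩ := Fin.exists_succAbove_eq hik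
    rw [hLeval]
    exact Finset.prod_eq_zero (Finset.mem_univ j) (sub_self _)
  set c : Fin (N + 1) → ℝ := fun k => G.eval (lam k) / (L k).eval (lam k) with hc
  have hcpos : ∀ k, 0 < c k := by
    intro k
    simp only [hc]
    rw [hLeval, hG, eval_prod, ← Finset.prod_div_distrib]
    refine Finset.prod_pos fun j _ => ?_
    simp only [eval_sub, eval_X, eval_C]
    rcases lt_or_ge j.castSucc k with h | h
    · rw [Fin.succAbove_of_castSucc_lt _ _ h]
      have h1 : lam k ≤ lam j.succ := hlam.antitone (Fin.castSucc_lt_iff_succ_le.1 h)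
      have h2 := hlam h
      have := (hint j).1
      exact div_pos_of_neg_of_neg (by linarith) (by linarith)
    · rw [Fin.succAbove_of_le_castSucc _ _ h]
      have h1 : lam j.castSucc ≤ lam k := hlam.antitone h
      have := hint j
      exact div_pos (by linarith) (by linarith)
  have hGsum : G = ∑ k, C (c k) * L k := by
    have hLdeg : ∀ k, (L k).natDegree = N := by
      intro k
      simp only [hL]
      rw [natDegree_prod_of_monic _ _ (fun i _ => monic_X_sub_C _)]
      simp
    have hGdeg : G.natDegree = N := by
      rw [hG]
      rw [natDegree_prod_of_monic _ _ (fun i _ => monic_X_sub_C _)]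
      simp
    refine Polynomial.eq_of_degrees_lt_of_eval_index_eq (s := Finset.univ) (v := lam)
      (hlam.injective.injOn) ?_ ?_ ?_
    · refine lt_of_le_of_lt degree_le_natDegree ?_
      rw [hGdeg]; simp
      exact_mod_cast Nat.lt_succ_self N
    · refine lt_of_le_of_lt (degree_sum_le _ _) ?_
      rw [Finset.sup_lt_iff]
      · intro k _
        refine lt_of_le_of_lt degree_le_natDegree ?_
        refine lt_of_le_of_lt (Nat.cast_le.2 (natDegree_C_mul_le _ _)) ?_
        rw [hLdeg]; simp
        exact_mod_cast Nat.lt_succ_self N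
      · simp
    · intro i _
      rw [eval_finsetSum, Finset.sum_eq_single i]
      · simp only [eval_mul, eval_C, hc]
        rw [div_mul_cancel₀ _ (hLne i)]
      · intro k _ hk
        rw [eval_mul, hLz k i hk.symm, mul_zero]
      · simp
  have hW : derivative F * G - F * derivative G = ∑ k, C (c k) * (L k) ^ 2 := by
    conv_lhs => rw [hGsum]
    rw [derivative_sum, Finset.mul_sum, Finset.mul_sum, ← Finset.sum_sub_distrib]
    refine Finset.sum_congr rfl fun k _ => ?_
    rw [hFL k]
    simp only [derivative_mul, derivative_sub, derivative_X, derivative_C]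
    ring
  rw [hW, eval_finsetSum]
  have hterm : ∀ k, 0 ≤ (C (c k) * (L k) ^ 2).eval x := by
    intro k
    simp only [eval_mul, eval_C, eval_pow]
    exact mul_nonneg (hcpos k).le (sq_nonneg _)
  have hex : ∃ k, (L k).eval x ≠ 0 := by
    by_cases h : ∃ k, x = lam k
    · obtain ⟨k, rfl⟩ := h
      exact ⟨k, hLne k⟩
    · refine ⟨0, ?_⟩
      rw [hLeval, Finset.prod_ne_zero_iff]
      intro j _ h0
      exact h ⟨_, sub_eq_zero.1 h0⟩
  obtain ⟨k, hk⟩ := hex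
  refine Finset.sum_pos' (fun k _ => hterm k) ⟨k, Finset.mem_univ k, ?_⟩
  simp only [eval_mul, eval_C, eval_pow]
  exact mul_pos (hcpos k) (by positivity)

open Polynomial in
theorem adj_sq_entry {n : ℕ} (M : Matrix (Fin n) (Fin n) ℝ) (i : Fin n) :
    ∑ k, M.charmatrix.adjugate i k * M.charmatrix.adjugate k i =
      derivative M.charpoly * M.charmatrix.adjugate i i
        - M.charpoly * derivative (M.charmatrix.adjugate i i) := by
  set D := M.charmatrix.adjugate with hD
  have h1 : D * M.charmatrix = M.charpoly • 1 := by
    rw [hD, Matrix.adjugate_mul]; rfl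
  have h2 : M.charmatrix * D = M.charpoly • 1 := by
    rw [hD, Matrix.mul_adjugate]; rfl
  have hder : (D.map derivative) * M.charmatrix + D = (derivative M.charpoly) • 1 := by
    ext1 a b
    have := congrArg derivative (congrFun (congrFun h1 a) b)
    rw [Matrix.mul_apply, derivative_sum] at this
    simp only [derivative_mul, Finset.sum_add_distrib] at this
    have h3 : ∑ x, D a x * derivative (M.charmatrix x b) = D a b := by
      rw [Finset.sum_eq_single b]
      · simp [Matrix.charmatrix_apply]
      · intro c _ hcb
        simp [Matrix.charmatrix_apply, hcb]
      · simp
    rw [h3] at this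
    rw [Matrix.add_apply, Matrix.mul_apply]
    simp only [Matrix.map_apply]
    rw [this]
    by_cases hab : a = b <;> simp [hab, Matrix.one_apply]
  have h4 : M.charpoly • (D.map derivative) + D * D = (derivative M.charpoly) • D := by
    have := congrArg (· * D) hder
    simp only [add_mul, mul_assoc, h2] at this
    simpa using this
  have h5 := congrFun (congrFun h4 i) i
  simp only [Matrix.add_apply, Matrix.mul_apply, Matrix.smul_apply, Matrix.map_apply,
    smul_eq_mul] at h5
  linear_combination h5

open Polynomial in
theorem left_adj (p q : ℕ) (hp : 1 ≤ p)
    (T : ℕ → ℕ → ℝ)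
    (hband : ∀ i j, (j + p < i ∨ i + q < j) → T i j = 0)
    (A : ℕ → ℕ → Polynomial ℝ)
    (hA0 : ∀ a, 1 ≤ a → a ≤ p → ∀ n, n < a - 1 → A a n = 0)
    (hA1 : ∀ a, 1 ≤ a → a ≤ p → A a (a - 1) = 1)
    (hArec : ∀ a, 1 ≤ a → a ≤ p → ∀ n,
      ∑ m ∈ Finset.Icc (n - q) (n + p), A a m * Polynomial.C (T m n)
        = Polynomial.X * A a n)
    (α : ℕ → ℝ)
    (hα : ∀ N, α N = (-1 : ℝ) ^ ((p - 1) * N) * ∏ k ∈ Finset.range N, T (k + p) k)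
    (Q : ℕ → ℕ → Polynomial ℝ)
    (hQ : ∀ n N, Q n N = (Matrix.of fun i a : Fin p =>
        if (i : ℕ) = 0 then A ((a : ℕ) + 1) n else A ((a : ℕ) + 1) (N + (i : ℕ))).det)
    (N : ℕ) :
    ∀ n : Fin (N + 1), C (α N) * Q n N =
      (Matrix.of fun i j : Fin (N + 1) => T i j).charmatrix.adjugate (Fin.last N) n := by
  obtain ⟨r, rfl⟩ : ∃ r, p = r + 1 := ⟨p - 1, by omega⟩
  simp only [Nat.add_sub_cancel] at hα
  -- recursion
  have hrec : ∀ N n, ∑ m ∈ Finset.Icc (n - q) (n + (r + 1)), Q m N * C (T m n) = X * Q n N := by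
    intro N n
    have hexp : ∀ m, Q m N = ∑ a : Fin (r + 1), A ((a : ℕ) + 1) m *
        ((-1) ^ (a : ℕ) * (Matrix.of fun i b : Fin r =>
          A ((a.succAbove b : ℕ) + 1) (N + ((i : ℕ) + 1))).det) := by
      intro m
      rw [hQ, Matrix.det_succ_row_zero]
      refine Finset.sum_congr rfl fun a _ => ?_
      have : (Matrix.of fun i a : Fin (r + 1) =>
        if (i : ℕ) = 0 then A ((a : ℕ) + 1) m else A ((a : ℕ) + 1) (N + (i : ℕ))).submatrix
          Fin.succ a.succAbove = Matrix.of fun i b : Fin r =>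
          A ((a.succAbove b : ℕ) + 1) (N + ((i : ℕ) + 1)) := by
        ext1 i b
        simp
      rw [this]
      simp
      ring
    simp only [hexp, Finset.sum_mul, Finset.mul_sum]
    rw [Finset.sum_comm]
    refine Finset.sum_congr rfl fun a _ => ?_
    have := hArec ((a : ℕ) + 1) (by omega) (by omega) n
    rw [← mul_assoc, ← this, Finset.sum_mul]
    refine Finset.sum_congr rfl fun m _ => ?_
    ring
  have hzero : ∀ N j, j < r → Q (N + 1 + j) N = 0 := by
    intro N j hj
    rw [hQ]
    refine Matrix.det_zero_of_row_eq (i := 0) (j := ⟨j + 1, by omega⟩) ?_ ?_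
    · intro h
      have := congrArg Fin.val h
      simp at this
    · ext1 a
      simp only [Matrix.of_apply]
      simp [show N + 1 + j = N + (j + 1) by omega]
  have hrot : ∀ N, Q (N + 1 + r) N = (-1) ^ r * Q (N + 1) (N + 1) := by
    intro N
    set M0 : Matrix (Fin (r + 1)) (Fin (r + 1)) ℝ[X] := (Matrix.of fun i a : Fin (r + 1) =>
        if (i : ℕ) = 0 then A ((a : ℕ) + 1) (N + 1 + r)
          else A ((a : ℕ) + 1) (N + (i : ℕ))) with hM0
    have h1 : Q (N + 1) (N + 1) = (M0.submatrix (finRotate (r + 1)) id).det := by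
      rw [hQ]
      congr 1
      ext1 i a
      simp only [Matrix.of_apply, Matrix.submatrix_apply, hM0, id]
      rcases Fin.eq_castSucc_or_eq_last i with ⟨j, rfl⟩ | rfl
      · have : ((finRotate (r + 1)) j.castSucc : ℕ) = j + 1 := by
          rw [coe_finRotate_of_ne_last (Fin.castSucc_lt_last j).ne]; simp
        rw [this]
        simp only [Fin.val_castSucc, Nat.succ_ne_zero, if_false]
        split_ifs with h
        · rw [h]
        · congr 1; omega
      · rw [finRotate_last]
        simp only [Fin.val_last, Fin.val_zero, if_true]
        split_ifs with h
        · congr 1; omega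
        · rfl
    rw [h1, Matrix.det_permute, sign_finRotate, hQ, ← hM0, ← mul_assoc]
    simp [← mul_pow]
  -- vector equation
  have hvec : ∀ N (n : Fin (N + 1)), ∑ m : Fin (N + 1), Q m N *
      (Matrix.of fun i j : Fin (N + 1) => T i j).charmatrix m n =
      if n = Fin.last N then Q (N + 1 + r) N * C (T (N + 1 + r) N) else 0 := by
    intro N n
    have hn : (n : ℕ) ≤ N := Nat.lt_succ_iff.1 n.2
    have h1 : ∑ m ∈ Finset.range (N + 1 + (r + 1)), Q m N * C (T m n) = X * Q n N := by
      rw [← hrec N n]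
      symm
      refine Finset.sum_subset ?_ ?_
      · intro m hm
        simp only [Finset.mem_Icc, Finset.mem_range] at *
        omega
      · intro m _ hm
        simp only [Finset.mem_Icc] at hm
        rw [hband m n (by omega)]
        simp
    rw [Finset.sum_range_add, Finset.sum_range_succ _ r,
      Finset.sum_eq_zero (s := Finset.range r)
        (fun j hj => by rw [hzero N j (Finset.mem_range.1 hj), zero_mul]), zero_add,
      Finset.sum_range (n := N + 1)] at h1
    have h2 : ∑ m : Fin (N + 1), Q m N *
      (Matrix.of fun i j : Fin (N + 1) => T i j).charmatrix m n =
        X * Q n N - ∑ m : Fin (N + 1), Q m N * C (T m n) := by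
      simp only [Matrix.charmatrix_apply, mul_sub, Finset.sum_sub_distrib, Matrix.of_apply]
      congr 1
      rw [Finset.sum_eq_single n]
      · simp [mul_comm]
      · intro b _ hb
        simp [hb]
      · simp
    rw [h2, ← h1]
    split_ifs with h
    · subst h
      simp
    · have : (n : ℕ) < N := lt_of_le_of_ne hn (fun h' => h (Fin.ext h'))
      rw [hband (N + 1 + r) n (by omega)]
      simp
  have hmul : ∀ N (n : Fin (N + 1)),
      Q n N * (Matrix.of fun i j : Fin (N + 1) => T i j).charpoly =
      Q (N + 1 + r) N * C (T (N + 1 + r) N) *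
        (Matrix.of fun i j : Fin (N + 1) => T i j).charmatrix.adjugate (Fin.last N) n := by
    intro N n
    set K := (Matrix.of fun i j : Fin (N + 1) => T i j).charmatrix with hK
    have hv : Matrix.vecMul (fun m : Fin (N + 1) => Q m N) K =
        fun n => if n = Fin.last N then Q (N + 1 + r) N * C (T (N + 1 + r) N) else 0 := by
      funext n
      exact hvec N n
    have h1 := congrArg (fun v => Matrix.vecMul v K.adjugate n) hv
    simp only [Matrix.vecMul_vecMul, Matrix.mul_adjugate] at h1
    have h2 : (Matrix.of fun i j : Fin (N + 1) => T i j).charpoly = K.det := rfl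
    rw [h2]
    simp only [Matrix.vecMul_smul, Matrix.vecMul_one, Pi.smul_apply, smul_eq_mul] at h1
    rw [mul_comm, h1]
    simp [Matrix.vecMul, dotProduct]
  have hlast : ∀ N, (Matrix.of fun i j : Fin (N + 1) => T i j).charmatrix.adjugate
      (Fin.last N) (Fin.last N) = (Matrix.of fun i j : Fin N => T i j).charpoly := by
    intro N
    rw [Matrix.adjugate_fin_succ_eq_det_submatrix, Matrix.charpoly]
    rw [← two_mul, pow_mul]
    simp only [even_two, Even.neg_pow, one_pow, one_mul]
    congr 1
    ext1 i j
    simp [Matrix.charmatrix_apply, Matrix.diagonal_apply]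
  have hαs : ∀ N, α (N + 1) = α N * ((-1) ^ r * T (N + 1 + r) N) := by
    intro N
    rw [hα, hα, Finset.prod_range_succ, mul_add, pow_add, mul_one,
      show N + 1 + r = N + (r + 1) by omega]
    ring
  have hstep : ∀ N, C (α N) * (Q (N + 1 + r) N * C (T (N + 1 + r) N)) =
      C (α (N + 1)) * Q (N + 1) (N + 1) := by
    intro N
    rw [hrot, hαs]
    simp
    ring
  have hdiag : ∀ N, C (α N) * Q N N = (Matrix.of fun i j : Fin N => T i j).charpoly := by
    intro N
    induction N with
    | zero =>
      have : Q 0 0 = 1 := by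
        rw [hQ, Matrix.det_of_isLowerTriangular]
        · refine Finset.prod_eq_one fun i _ => ?_
          have := hA1 ((i : ℕ) + 1) (by omega) (by omega)
          simp only [Nat.add_sub_cancel] at this
          simp only [Matrix.of_apply]
          split_ifs with h
          · rw [h] at this ⊢; exact this
          · rw [zero_add]; exact this
        · intro i j hij
          have hij' : (i : ℕ) < j := hij
          have := hA0 ((j : ℕ) + 1) (by omega) (by omega) i (by omega)
          simp only [Matrix.of_apply]
          split_ifs with h
          · rw [h] at this; exact this
          · rw [zero_add]; exact this
      rw [this, hα]
      simp [Matrix.charpoly]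
    | succ N ih =>
      have h1 := hmul N (Fin.last N)
      rw [hlast, Fin.val_last] at h1
      have hne : (Matrix.of fun i j : Fin N => T i j).charpoly ≠ 0 :=
        (Matrix.charpoly_monic _).ne_zero
      refine mul_right_cancel₀ hne ?_
      rw [← hstep]
      linear_combination (Matrix.of fun i j : Fin (N + 1) => T i j).charpoly * ih - C (α N) * h1
  intro n
  have hne : (Matrix.of fun i j : Fin (N + 1) => T i j).charpoly ≠ 0 :=
    (Matrix.charpoly_monic _).ne_zero
  refine mul_right_cancel₀ hne ?_
  rw [mul_assoc, hmul, ← mul_assoc, hstep, hdiag, mul_comm]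

open Polynomial in
theorem adj_last_last (T : ℕ → ℕ → ℝ) (N : ℕ) :
    (Matrix.of fun i j : Fin (N + 1) => T i j).charmatrix.adjugate
      (Fin.last N) (Fin.last N) = (Matrix.of fun i j : Fin N => T i j).charpoly := by
  rw [Matrix.adjugate_fin_succ_eq_det_submatrix, Matrix.charpoly]
  rw [← two_mul, pow_mul]
  simp only [even_two, Even.neg_pow, one_pow, one_mul]
  congr 1
  ext1 i j
  simp [Matrix.charmatrix_apply, Matrix.diagonal_apply]

/-- If the characteristic polynomials `P_{N+1}` and `P_N` of a `(p,q)`-banded matrix with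
nonvanishing extreme diagonals have only real simple roots which strictly interlace, then
the confluent Christoffel–Darboux kernel `α_N β_N ∑_{n=0}^{N} Q_{n,N}(x) R_{n,N}(x)` is
strictly positive for every real `x`. -/
theorem confluent_kernel_pos
    (p q : ℕ) (hp : 1 ≤ p) (hq : 1 ≤ q)
    (T : ℕ → ℕ → ℝ)
    (hband : ∀ i j, (j + p < i ∨ i + q < j) → T i j = 0)
    (hext : ∀ n, T (n + p) n ≠ 0 ∧ T n (n + q) ≠ 0)
    (ν : ℕ → ℕ → ℝ) (A : ℕ → ℕ → Polynomial ℝ)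
    (hA0 : ∀ a, 1 ≤ a → a ≤ p → ∀ n, n < a - 1 → A a n = 0)
    (hA1 : ∀ a, 1 ≤ a → a ≤ p → A a (a - 1) = 1)
    (hAconst : ∀ a, 1 ≤ a → a ≤ p → ∀ j, a ≤ j → j ≤ p - 1 → A a j = Polynomial.C (ν a j))
    (hArec : ∀ a, 1 ≤ a → a ≤ p → ∀ n,
      ∑ m ∈ Finset.Icc (n - q) (n + p), A a m * Polynomial.C (T m n)
        = Polynomial.X * A a n)
    (ξ : ℕ → ℕ → ℝ) (B : ℕ → ℕ → Polynomial ℝ)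
    (hB0 : ∀ b, 1 ≤ b → b ≤ q → ∀ n, n < b - 1 → B b n = 0)
    (hB1 : ∀ b, 1 ≤ b → b ≤ q → B b (b - 1) = 1)
    (hBconst : ∀ b, 1 ≤ b → b ≤ q → ∀ j, b ≤ j → j ≤ q - 1 → B b j = Polynomial.C (ξ b j))
    (hBrec : ∀ b, 1 ≤ b → b ≤ q → ∀ n,
      ∑ m ∈ Finset.Icc (n - p) (n + q), Polynomial.C (T n m) * B b m
        = Polynomial.X * B b n)
    (P : ℕ → Polynomial ℝ)
    (hP0 : P 0 = 1)
    (hPsucc : ∀ N, P (N + 1) = (Matrix.of fun i j : Fin (N + 1) => T i j).charpoly)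
    (α : ℕ → ℝ)
    (hα : ∀ N, α N = (-1 : ℝ) ^ ((p - 1) * N) * ∏ k ∈ Finset.range N, T (k + p) k)
    (β : ℕ → ℝ)
    (hβ : ∀ N, β N = (-1 : ℝ) ^ ((q - 1) * N) * ∏ k ∈ Finset.range N, T k (k + q))
    (Q : ℕ → ℕ → Polynomial ℝ)
    (hQ : ∀ n N, Q n N = (Matrix.of fun i a : Fin p =>
        if (i : ℕ) = 0 then A ((a : ℕ) + 1) n else A ((a : ℕ) + 1) (N + (i : ℕ))).det)
    (R : ℕ → ℕ → Polynomial ℝ)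
    (hR : ∀ n N, R n N = (Matrix.of fun i b : Fin q =>
        if (i : ℕ) = 0 then B ((b : ℕ) + 1) n else B ((b : ℕ) + 1) (N + (i : ℕ))).det)
    (N : ℕ) (lam : Fin (N + 1) → ℝ) (mu : Fin N → ℝ)
    (hlam : StrictAnti lam) (hmu : StrictAnti mu)
    (hPN1 : P (N + 1) = ∏ k, (Polynomial.X - Polynomial.C (lam k)))
    (hPN : P N = ∏ k, (Polynomial.X - Polynomial.C (mu k)))
    (hint : ∀ k : Fin N, lam k.succ < mu k ∧ mu k < lam k.castSucc) :
    ∀ x : ℝ,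
      0 < α N * β N * ∑ n ∈ Finset.range (N + 1), (Q n N).eval x * (R n N).eval x := by
  intro x
  have hl := left_adj p q hp T hband A hA0 hA1 hArec α hα Q hQ N
  have hr := left_adj q p hq (fun i j => T j i) (fun i j h => hband j i h.symm) B hB0 hB1
    (fun b h1 h2 n => by
      rw [← hBrec b h1 h2 n]
      exact Finset.sum_congr rfl fun m _ => mul_comm _ _) β hβ R hR N
  have htr : (Matrix.of fun i j : Fin (N + 1) => T j i).charmatrix =
      (Matrix.of fun i j : Fin (N + 1) => T i j).charmatrix.transpose := by
    rw [← Matrix.charmatrix_transpose]; rfl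
  have hPN' : P N = (Matrix.of fun i j : Fin N => T i j).charpoly := by
    cases N with
    | zero => rw [hP0]; simp [Matrix.charpoly]
    | succ N => exact hPsucc N
  have key := adj_sq_entry (Matrix.of fun i j : Fin (N + 1) => T i j) (Fin.last N)
  rw [adj_last_last, ← hPN', ← hPsucc] at key
  have hpos := interlace_pos N lam mu hlam hint _ _ hPN1 hPN x
  rw [← key, Polynomial.eval_finsetSum] at hpos
  rw [Finset.sum_range, Finset.mul_sum]
  convert hpos using 2 with n
  rw [← hl n]
  have h2 := hr n
  rw [htr, ← Matrix.adjugate_transpose, Matrix.transpose_apply] at h2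
  rw [← h2]
  simp only [Polynomial.eval_mul, Polynomial.eval_C]
  ring
end
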